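/- arXiv:1204.4828 — 2 statements merged into one kernel-verified Lean document; each statement's English description precedes it below -/
import Mathlib

section
/- Let k be a field of characteristic zero, g a Lie algebra over k, and U(g) its universal enveloping algebra with its standard bialgebra structure. Suppose φ ∈ U(g)⊗U(g) satisfies the 2-cocycle condition 1⊗φ + (I⊗Δ)(φ) = φ⊗1 + (Δ⊗I)(φ) and is invariant, i.e. [φ, Δ(u)] = 0 for all u ∈ U(g). Then there exists a central element a ∈ Z(U(g)) such that φ = Alt₂(φ) + a⊗1 + 1⊗a − Δ(a), where Alt₂(φ) = (φ − τ(φ))/2. -/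
open scoped TensorProduct

noncomputable section
namespace CoH
variable {K H A : Type*} [Field K] [Ring H] [Algebra K H] [Ring A] [Algebra K A]

/-- evaluation of a 2-tensor on two linear maps -/
def ev (f g : H →ₗ[K] A) : H ⊗[K] H →ₗ[K] A :=
  LinearMap.mul' K A ∘ₗ TensorProduct.map f g

@[simp] lemma ev_tmul (f g : H →ₗ[K] A) (x y : H) : ev f g (x ⊗ₜ[K] y) = f x * g y := by
  simp [ev]

/-- convolution -/
def conv (Δ : H →ₐ[K] H ⊗[K] H) (f g : H →ₗ[K] A) : H →ₗ[K] A := ev f g ∘ₗ Δ.toLinearMap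

/-- evaluation of a 3-tensor -/
def ev3 (f g h : H →ₗ[K] A) : H ⊗[K] (H ⊗[K] H) →ₗ[K] A :=
  LinearMap.mul' K A ∘ₗ TensorProduct.map f (ev g h)

@[simp] lemma ev3_tmul (f g h : H →ₗ[K] A) (x : H) (w : H ⊗[K] H) :
    ev3 f g h (x ⊗ₜ[K] w) = f x * ev g h w := by
  simp [ev3]

lemma ev3_assoc (f g h : H →ₗ[K] A) (w : H ⊗[K] H) (z : H) :
    ev3 f g h (TensorProduct.assoc K H H H (w ⊗ₜ[K] z)) = ev f g w * h z := by
  induction w with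
  | zero => simp
  | tmul x y => simp [mul_assoc]
  | add a b ha hb => simp [TensorProduct.add_tmul, add_mul, ha, hb]

variable (Δ : H →ₐ[K] H ⊗[K] H)

lemma ev3_lTensor (f g h : H →ₗ[K] A) (w : H ⊗[K] H) :
    ev3 f g h (LinearMap.lTensor H Δ.toLinearMap w) = ev f (conv Δ g h) w := by
  induction w with
  | zero => simp
  | tmul x y => simp [conv]
  | add a b ha hb => simp only [map_add, ha, hb]

lemma ev3_rTensor (f g h : H →ₗ[K] A) (w : H ⊗[K] H) :
    ev3 f g h (TensorProduct.assoc K H H H (LinearMap.rTensor H Δ.toLinearMap w))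
      = ev (conv Δ f g) h w := by
  induction w with
  | zero => simp
  | tmul x y => simp [conv, ev3_assoc]
  | add a b ha hb => simp only [map_add, ha, hb]

/-- the differential in degree two -/
def D : H ⊗[K] H →ₗ[K] H ⊗[K] (H ⊗[K] H) :=
  TensorProduct.mk K H (H ⊗[K] H) 1 + LinearMap.lTensor H Δ.toLinearMap
    - (TensorProduct.assoc K H H H).toLinearMap ∘ₗ
      ((TensorProduct.mk K (H ⊗[K] H) H).flip 1 + LinearMap.rTensor H Δ.toLinearMap)

lemma D_apply (φ : H ⊗[K] H) : D Δ φ = (1 : H) ⊗ₜ[K] φ + LinearMap.lTensor H Δ.toLinearMap φ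
      - TensorProduct.assoc K H H H (φ ⊗ₜ[K] (1 : H) + LinearMap.rTensor H Δ.toLinearMap φ) := rfl

lemma cocycle_ev {φ : H ⊗[K] H} (h : D Δ φ = 0) (a b c : H →ₗ[K] A) (ha : a 1 = 1)
    (hc : c 1 = 1) : ev b c φ + ev a (conv Δ b c) φ = ev a b φ + ev (conv Δ a b) c φ := by
  have := congrArg (ev3 a b c) (sub_eq_zero.1 ((D_apply Δ φ).symm.trans h))
  simpa [ev3_assoc, ev3_lTensor, ev3_rTensor, ha, hc] using this

/-- the differential in degree one -/
def d : H →ₗ[K] H ⊗[K] H :=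
  (TensorProduct.mk K H H).flip 1 + TensorProduct.mk K H H 1 - Δ.toLinearMap

lemma d_apply (a : H) : d Δ a = a ⊗ₜ[K] 1 + 1 ⊗ₜ[K] a - Δ a := rfl

variable (hco : ∀ u, TensorProduct.assoc K H H H (LinearMap.rTensor H Δ.toLinearMap (Δ u))
    = LinearMap.lTensor H Δ.toLinearMap (Δ u))
  (hcm : ∀ u, TensorProduct.comm K H H (Δ u) = Δ u)

/-- first inclusion -/
abbrev i1 : H →ₗ[K] H ⊗[K] H := (TensorProduct.mk K H H).flip 1
/-- second inclusion -/
abbrev i2 : H →ₗ[K] H ⊗[K] H := (TensorProduct.mk K H H) 1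

include hco in
lemma conv_assoc (f g h : H →ₗ[K] A) : conv Δ f (conv Δ g h) = conv Δ (conv Δ f g) h := by
  ext u
  have := congrArg (ev3 f g h) (hco u)
  rw [ev3_lTensor, ev3_rTensor] at this
  exact this.symm

lemma ev_12 (w : H ⊗[K] H) : ev i1 i2 w = w := by
  induction w with
  | zero => simp
  | tmul x y => simp
  | add a b ha hb => simp only [map_add, ha, hb]

lemma ev_21 (w : H ⊗[K] H) : ev i2 i1 w = TensorProduct.comm K H H w := by
  induction w with
  | zero => simp
  | tmul x y => simp
  | add a b ha hb => simp only [map_add, ha, hb]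

lemma ev_11 (w : H ⊗[K] H) : ev i1 i1 w = (LinearMap.mul' K H w) ⊗ₜ[K] (1 : H) := by
  induction w with
  | zero => simp
  | tmul x y => simp
  | add a b ha hb => simp only [map_add, ha, hb, TensorProduct.add_tmul]

lemma ev_22 (w : H ⊗[K] H) : ev i2 i2 w = (1 : H) ⊗ₜ[K] (LinearMap.mul' K H w) := by
  induction w with
  | zero => simp
  | tmul x y => simp
  | add a b ha hb => simp only [map_add, ha, hb, TensorProduct.tmul_add]

lemma conv_12 : conv Δ i1 i2 = Δ.toLinearMap := by
  ext u; simp [conv, ev_12]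

include hcm in
lemma conv_21 : conv Δ i2 i1 = Δ.toLinearMap := by
  ext u; simp [conv, ev_21, hcm]

/-- the second Adams operation -/
def Ps : H →ₗ[K] H := LinearMap.mul' K H ∘ₗ Δ.toLinearMap

lemma Ps_apply (u : H) : Ps Δ u = LinearMap.mul' K H (Δ u) := rfl

lemma ev_1122 (w : H ⊗[K] H) :
    ev (conv Δ i1 i1) (conv Δ i2 i2) w = TensorProduct.map (Ps Δ) (Ps Δ) w := by
  induction w with
  | zero => simp
  | tmul x y => simp [conv, ev_11, ev_22, Ps]
  | add a b ha hb => simp only [map_add, ha, hb]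

lemma ev_1212 (w : H ⊗[K] H) :
    ev Δ.toLinearMap Δ.toLinearMap w = Δ (LinearMap.mul' K H w) := by
  induction w with
  | zero => simp
  | tmul x y => simp
  | add a b ha hb => simp only [map_add, ha, hb]

include hco hcm in
lemma key {ψ : H ⊗[K] H} (h : D Δ ψ = 0) (hs : TensorProduct.comm K H H ψ = ψ) :
    TensorProduct.map (Ps Δ) (Ps Δ) ψ = (2 : K) • ψ - d Δ (LinearMap.mul' K H ψ) := by
  have h1 : (i1 : H →ₗ[K] H ⊗[K] H) 1 = 1 := rfl
  have h2 : (i2 : H →ₗ[K] H ⊗[K] H) 1 = 1 := rfl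
  have h3 : Δ.toLinearMap 1 = 1 := by simp
  have h22 : conv Δ (i2 : H →ₗ[K] H ⊗[K] H) i2 1 = 1 := by
    simp [conv, Algebra.TensorProduct.one_def]
  have e1 := cocycle_ev Δ h i1 i2 (conv Δ i1 i2) h1 (by rw [conv_12]; exact h3)
  have e2 := cocycle_ev Δ h i1 i1 (conv Δ i2 i2) h1 h22
  have e3 := cocycle_ev Δ h i2 i1 i2 h2 h2
  have e4 := cocycle_ev Δ h i1 i2 i2 h1 h2
  rw [conv_assoc Δ hco] at e1 e2
  rw [← conv_assoc Δ hco] at e2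
  rw [conv_21 Δ hcm] at e1 e3
  have e5 : conv Δ (i1 : H →ₗ[K] H ⊗[K] H) (conv Δ i2 i2) = conv Δ Δ.toLinearMap i2 := by
    rw [conv_assoc Δ hco, conv_12]
  rw [e5] at e2
  rw [conv_12] at e1 e3 e4
  rw [ev_12] at e1 e3 e4
  rw [ev_1212] at e1
  rw [ev_11, ev_1122] at e2
  rw [ev_22] at e4
  rw [ev_21, hs] at e3
  rw [d_apply, two_smul]
  have e2' := eq_sub_of_add_eq' e2.symm
  rw [e2']
  have e1' := eq_sub_of_add_eq' e1.symm
  rw [e1']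
  have e4' := eq_sub_of_add_eq e4
  have e3' := eq_sub_of_add_eq' e3
  have : ev i2 Δ.toLinearMap ψ = ev Δ.toLinearMap i2 ψ := by
    rw [e3']; abel
  rw [this]
  have e4'' := eq_sub_of_add_eq' e4
  rw [e4'']
  abel

include hco in
lemma D_d (a : H) : D Δ (d Δ a) = 0 := by
  rw [D_apply, d_apply]
  simp only [map_add, map_sub, LinearMap.lTensor_tmul, LinearMap.rTensor_tmul,
    TensorProduct.add_tmul, TensorProduct.sub_tmul, TensorProduct.tmul_add, TensorProduct.tmul_sub,
    hco, AlgHom.toLinearMap_apply, map_one, Algebra.TensorProduct.one_def, TensorProduct.assoc_tmul]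
  abel

include hcm in
lemma comm_d (a : H) : TensorProduct.comm K H H (d Δ a) = d Δ a := by
  simp only [d_apply, map_add, map_sub, TensorProduct.comm_tmul, hcm]
  abel

/-- reversal of three factors -/
def rev3 : H ⊗[K] (H ⊗[K] H) →ₗ[K] H ⊗[K] (H ⊗[K] H) :=
  (TensorProduct.assoc K H H H).toLinearMap ∘ₗ (TensorProduct.comm K H (H ⊗[K] H)).toLinearMap
   ∘ₗ LinearMap.lTensor H (TensorProduct.comm K H H).toLinearMap

lemma rev3_tmul (a : H) (w : H ⊗[K] H) : rev3 (a ⊗ₜ[K] w) =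
    TensorProduct.assoc K H H H (TensorProduct.comm K H H w ⊗ₜ[K] a) := by
  simp [rev3]

lemma rev3_assoc (a : H) (w : H ⊗[K] H) : rev3 (TensorProduct.assoc K H H H (w ⊗ₜ[K] a)) =
    a ⊗ₜ[K] TensorProduct.comm K H H w := by
  induction w with
  | zero => simp
  | tmul x y => simp [rev3]
  | add a b ha hb => simp only [map_add, ha, hb, TensorProduct.add_tmul, TensorProduct.tmul_add]

include hcm in
lemma D_comm (φ : H ⊗[K] H) : D Δ (TensorProduct.comm K H H φ) = - rev3 (D Δ φ) := by
  induction φ with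
  | zero => simp
  | add a b ha hb => simp only [map_add, ha, hb, neg_add]
  | tmul x y =>
    simp only [D_apply, TensorProduct.comm_tmul, map_add, map_sub, LinearMap.lTensor_tmul,
      LinearMap.rTensor_tmul, rev3_tmul, rev3_assoc, AlgHom.toLinearMap_apply, hcm]
    abel

/-- invariant symmetric cocycles -/
structure Good (ψ : H ⊗[K] H) : Prop where
  coc : D Δ ψ = 0
  symm : TensorProduct.comm K H H ψ = ψ
  inv : ∀ u, ψ * Δ u = Δ u * ψ

include hco hcm in
lemma good_d {a : H} (ha : ∀ u, a * u = u * a) : Good Δ (d Δ a) := by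
  refine ⟨D_d Δ hco a, comm_d Δ hcm a, fun u => ?_⟩
  have h1 : ∀ w : H ⊗[K] H, (a ⊗ₜ[K] (1 : H)) * w = w * (a ⊗ₜ[K] (1 : H)) := by
    intro w
    induction w with
    | zero => simp
    | tmul x y => simp [ha]
    | add a b ha hb => simp only [mul_add, add_mul, ha, hb]
  have h2 : ∀ w : H ⊗[K] H, ((1 : H) ⊗ₜ[K] a) * w = w * ((1 : H) ⊗ₜ[K] a) := by
    intro w
    induction w with
    | zero => simp
    | tmul x y => simp [ha]
    | add a b ha hb => simp only [mul_add, add_mul, ha, hb]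
  simp only [d_apply, add_mul, sub_mul, mul_add, mul_sub, h1, h2, ← map_mul, ha]

lemma Good.comb {ψ χ : H ⊗[K] H} (h : Good Δ ψ) (h' : Good Δ χ) (c : K) :
    Good Δ (c • ψ - χ) := by
  refine ⟨by simp [h.coc, h'.coc], by simp [h.symm, h'.symm], fun u => ?_⟩
  simp [sub_mul, mul_sub, h.inv, h'.inv]

lemma base (ε : H →ₐ[K] K)
    (hε : ∀ u, TensorProduct.lid K H (LinearMap.rTensor H ε.toLinearMap (Δ u)) = u)
    (hε' : ∀ u, TensorProduct.rid K H (LinearMap.lTensor H ε.toLinearMap (Δ u)) = u) 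
    (p q : H) (h : D Δ ((1 : H) ⊗ₜ[K] p + q ⊗ₜ[K] (1 : H)) = 0) :
    ∃ c : K, (1 : H) ⊗ₜ[K] p + q ⊗ₜ[K] (1 : H) = d Δ (algebraMap K H c) := by
  set e : H →ₗ[K] H := Algebra.linearMap K H ∘ₗ ε.toLinearMap with he
  have e1 : e 1 = 1 := by simp [e]
  have c1 : conv Δ e LinearMap.id = LinearMap.id := by
    ext u
    conv_rhs => rw [LinearMap.id_apply, ← hε u]
    simp only [conv, LinearMap.comp_apply, AlgHom.toLinearMap_apply]
    generalize Δ u = w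
    induction w with
    | zero => simp
    | tmul x y => simp [e, Algebra.smul_def]
    | add a b ha hb => simp only [map_add, ha, hb]
  have c2 : conv Δ LinearMap.id e = LinearMap.id := by
    ext u
    conv_rhs => rw [LinearMap.id_apply, ← hε' u]
    simp only [conv, LinearMap.comp_apply, AlgHom.toLinearMap_apply]
    generalize Δ u = w
    induction w with
    | zero => simp
    | tmul x y => simp [e, Algebra.smul_def, Algebra.commutes]
    | add a b ha hb => simp only [map_add, ha, hb]
  have c3 : conv Δ e e = e := by
    ext u
    have : conv Δ e e u = e (conv Δ e LinearMap.id u) := by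
      simp only [conv, LinearMap.comp_apply, AlgHom.toLinearMap_apply]
      generalize Δ u = w
      induction w with
      | zero => simp
      | tmul x y => simp [e]
      | add a b ha hb => simp only [map_add, ha, hb]
    rw [this, c1]; rfl
  have a1 := cocycle_ev Δ h e e LinearMap.id e1 rfl
  have a2 := cocycle_ev Δ h LinearMap.id e e rfl e1
  rw [c1, c3] at a1
  rw [c2, c3] at a2
  simp [e1] at a1 a2
  refine ⟨ε p + ε q, ?_⟩
  rw [d_apply, AlgHom.commutes, Algebra.TensorProduct.algebraMap_apply, add_sub_cancel_left]
  have a1' : p = algebraMap K H (ε p) := a1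
  have a2' : q = algebraMap K H (ε q) := a2.symm
  conv_lhs => rw [a1', a2']
  rw [map_add, TensorProduct.tmul_add, Algebra.algebraMap_eq_smul_one, Algebra.algebraMap_eq_smul_one]
  simp [TensorProduct.smul_tmul]


section filtration
variable (P : Submodule K H)

/-- the filtration -/
def F (n : ℕ) : Submodule K H := (1 ⊔ P) ^ n

lemma F_mul {i j : ℕ} {u v : H} (hu : u ∈ F P i) (hv : v ∈ F P j) : u * v ∈ F P (i + j) := by
  rw [F, pow_add]; exact Submodule.mul_mem_mul hu hv

lemma one_mem_F1 : (1 : H) ∈ F P 1 := by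
  rw [F, pow_one]; exact Submodule.mem_sup_left (Submodule.one_le.1 le_rfl)

lemma mem_F1 {x : H} (hx : x ∈ P) : x ∈ F P 1 := by
  rw [F, pow_one]; exact Submodule.mem_sup_right hx

lemma F_mono : Monotone (F P) := by
  refine monotone_nat_of_le_succ fun n u hu => ?_
  simpa using F_mul P hu (one_mem_F1 P)

lemma F_zero {u : H} (hu : u ∈ F P 0) : ∃ c : K, u = algebraMap K H c := by
  rw [F, pow_zero, Submodule.mem_one] at hu
  obtain ⟨c, rfl⟩ := hu; exact ⟨c, rfl⟩

/-- induction principle for the filtration -/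
lemma F_succ_induction {n : ℕ} {C : H → Prop} (h1 : ∀ v ∈ F P n, C v)
    (h2 : ∀ x ∈ P, ∀ v ∈ F P n, C (x * v)) (h3 : ∀ u v, C u → C v → C (u + v))
    {u : H} (hu : u ∈ F P (n + 1)) : C u := by
  rw [F, pow_succ'] at hu
  induction hu using Submodule.mul_induction_on' with
  | mem_mul_mem m hm v hv =>
    obtain ⟨y, hy, x, hx, rfl⟩ := Submodule.mem_sup.1 hm
    obtain ⟨c, rfl⟩ := Submodule.mem_one.1 hy
    rw [add_mul]
    refine h3 _ _ (h1 _ ?_) (h2 x hx v hv)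
    rw [← Algebra.smul_def]
    exact Submodule.smul_mem _ _ hv
  | add u _ v _ hu hv => exact h3 _ _ hu hv

lemma F_ad (hP : ∀ x ∈ P, ∀ y ∈ P, x * y - y * x ∈ P) {x : H} (hx : x ∈ P) (n : ℕ) :
    ∀ u ∈ F P n, u * x - x * u ∈ F P n := by
  induction n with
  | zero =>
    intro u hu
    obtain ⟨c, rfl⟩ := F_zero P hu
    simp [Algebra.commutes]
  | succ n ih =>
    intro u hu
    refine F_succ_induction P (C := fun u => u * x - x * u ∈ F P (n + 1)) ?_ ?_ ?_ hu
    · intro v hv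
      exact F_mono P (Nat.le_succ n) (ih v hv)
    · intro y hy v hv
      have : y * v * x - x * (y * v) = y * (v * x - x * v) + (y * x - x * y) * v := by
        noncomm_ring
      rw [this, add_comm n 1]
      exact add_mem (F_mul P (mem_F1 P hy) (ih v hv)) (F_mul P (mem_F1 P (hP y hy x hx)) hv)
    · intro u v hu hv
      have : (u + v) * x - x * (u + v) = (u * x - x * u) + (v * x - x * v) := by noncomm_ring
      rw [this]; exact add_mem hu hv

/-- the filtration on the tensor square -/
def F2 (n : ℕ) : Submodule K (H ⊗[K] H) :=
  Submodule.span K {w | ∃ i j, i + j = n ∧ ∃ u ∈ F P i, ∃ v ∈ F P j, w = u ⊗ₜ[K] v}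

lemma F2_mem {i j n : ℕ} (h : i + j ≤ n) {u v : H} (hu : u ∈ F P i) (hv : v ∈ F P j) :
    u ⊗ₜ[K] v ∈ F2 P n :=
  Submodule.subset_span ⟨i, n - i, by omega, u, hu, v, F_mono P (by omega) hv, rfl⟩

lemma F2_mono : Monotone (F2 P) := by
  refine monotone_nat_of_le_succ fun n => Submodule.span_le.2 ?_
  rintro _ ⟨i, j, rfl, u, hu, v, hv, rfl⟩
  exact F2_mem P (Nat.le_succ _) hu hv

lemma F2_mul {x : H} (hx : x ∈ P) {n : ℕ} {w : H ⊗[K] H} (hw : w ∈ F2 P n) :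
    (x ⊗ₜ[K] (1 : H) + (1 : H) ⊗ₜ[K] x) * w ∈ F2 P (n + 1) := by
  induction hw using Submodule.span_induction with
  | zero => simp
  | add a b _ _ ha hb => rw [mul_add]; exact add_mem ha hb
  | smul c a _ ha => rw [mul_smul_comm]; exact Submodule.smul_mem _ _ ha
  | mem w hw =>
    obtain ⟨i, j, rfl, u, hu, v, hv, rfl⟩ := hw
    simp only [add_mul, Algebra.TensorProduct.tmul_mul_tmul, one_mul]
    exact add_mem (F2_mem P (by omega) (F_mul P (mem_F1 P hx) hu) hv)
      (F2_mem P (by omega) hu (F_mul P (mem_F1 P hx) hv))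

variable (hΔ : ∀ x ∈ P, Δ x = x ⊗ₜ[K] (1 : H) + (1 : H) ⊗ₜ[K] x)
  (hP : ∀ x ∈ P, ∀ y ∈ P, x * y - y * x ∈ P)

include hΔ in
lemma F_comul (n : ℕ) : ∀ u ∈ F P n, Δ u ∈ F2 P n := by
  induction n with
  | zero =>
    intro u hu
    obtain ⟨c, rfl⟩ := F_zero P hu
    rw [AlgHom.commutes, Algebra.TensorProduct.algebraMap_apply]
    refine F2_mem P (i := 0) (j := 0) le_rfl hu ?_
    rw [F, pow_zero]; exact Submodule.one_le.1 le_rfl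
  | succ n ih =>
    intro u hu
    refine F_succ_induction P (C := fun u => Δ u ∈ F2 P (n + 1)) ?_ ?_ ?_ hu
    · intro v hv
      exact F2_mono P (Nat.le_succ n) (ih v hv)
    · intro x hx v hv
      rw [map_mul, hΔ x hx]
      exact F2_mul P hx (ih v hv)
    · intro u v hu hv
      rw [map_add]; exact add_mem hu hv

include hP in
lemma F2_ad {x : H} (hx : x ∈ P) {n : ℕ} {w : H ⊗[K] H} (hw : w ∈ F2 P n) :
    LinearMap.mul' K H ((x ⊗ₜ[K] (1 : H) + (1 : H) ⊗ₜ[K] x) * w)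
      - (2 : K) • (x * LinearMap.mul' K H w) ∈ F P n := by
  induction hw using Submodule.span_induction with
  | zero => simp
  | add a b _ _ ha hb =>
    convert add_mem ha hb using 1
    simp only [mul_add, map_add, smul_add]
    abel
  | smul c a _ ha =>
    convert Submodule.smul_mem _ c ha using 1
    simp only [mul_smul_comm, map_smul, smul_sub, smul_comm c]
  | mem w hw =>
    obtain ⟨i, j, rfl, u, hu, v, hv, rfl⟩ := hw
    convert F_mul P (F_ad P hP hx i u hu) hv using 1
    simp only [add_mul, Algebra.TensorProduct.tmul_mul_tmul, one_mul, map_add,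
      LinearMap.mul'_apply, two_smul]
    noncomm_ring

include hΔ hP in
lemma F_Ps (n : ℕ) : ∀ u ∈ F P (n + 1), Ps Δ u - (2 ^ (n + 1) : K) • u ∈ F P n := by
  have step : ∀ n, ∀ x ∈ P, ∀ v ∈ F P n,
      Ps Δ (x * v) - (2 : K) • (x * Ps Δ v) ∈ F P n := by
    intro n x hx v hv
    have := F2_ad P hP hx (F_comul Δ P hΔ n v hv)
    rwa [← hΔ x hx, ← map_mul] at this
  have hadd : ∀ (c : K) (n : ℕ) (u v : H), Ps Δ u - c • u ∈ F P n → Ps Δ v - c • v ∈ F P n →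
      Ps Δ (u + v) - c • (u + v) ∈ F P n := by
    intro c n u v hu hv
    convert add_mem hu hv using 1
    simp only [map_add, smul_add]
    abel
  have zero : ∀ v ∈ F P 0, Ps Δ v = v := by
    intro v hv
    obtain ⟨c, rfl⟩ := F_zero P hv
    rw [Ps_apply, AlgHom.commutes, Algebra.TensorProduct.algebraMap_apply]
    simp
  induction n with
  | zero =>
    intro u hu
    refine F_succ_induction P (C := fun u => Ps Δ u - (2 ^ (0 + 1) : K) • u ∈ F P 0) ?_ ?_
      (hadd _ _) hu
    · intro v hv
      rw [zero v hv]
      exact sub_mem hv (Submodule.smul_mem _ _ hv)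
    · intro x hx v hv
      have := step 0 x hx v hv
      rw [zero v hv] at this
      simpa using this
  | succ n ih =>
    intro u hu
    refine F_succ_induction P
      (C := fun u => Ps Δ u - (2 ^ (n + 1 + 1) : K) • u ∈ F P (n + 1)) ?_ ?_ (hadd _ _) hu
    · intro v hv
      have h1 := F_mono P (Nat.le_succ n) (ih v hv)
      have h2 := add_mem h1 (Submodule.smul_mem _ (2 ^ (n + 1) - 2 ^ (n + 1 + 1) : K) hv)
      convert h2 using 1
      module
    · intro x hx v hv
      have h1 := F_mul P (mem_F1 P hx) (ih v hv)
      rw [add_comm 1 n] at h1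
      convert add_mem (step _ x hx v hv) (Submodule.smul_mem _ (2 : K) h1) using 1
      rw [mul_sub, mul_smul_comm]
      module

include hΔ hP in
lemma F2_T (n : ℕ) {w : H ⊗[K] H} (hw : w ∈ F2 P (n + 1)) :
    TensorProduct.map (Ps Δ) (Ps Δ) w - (2 ^ (n + 1) : K) • w ∈ F2 P n := by
  have zero : ∀ v ∈ F P 0, Ps Δ v = v := by
    intro v hv
    obtain ⟨c, rfl⟩ := F_zero P hv
    rw [Ps_apply, AlgHom.commutes, Algebra.TensorProduct.algebraMap_apply]
    simp
  induction hw using Submodule.span_induction with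
  | zero => simp
  | add a b _ _ ha hb =>
    convert add_mem ha hb using 1
    simp only [map_add, smul_add]
    abel
  | smul c a _ ha =>
    convert Submodule.smul_mem _ c ha using 1
    simp only [map_smul, smul_sub, smul_comm c]
  | mem w hw =>
    obtain ⟨i, j, hij, u, hu, v, hv, rfl⟩ := hw
    rw [TensorProduct.map_tmul]
    rcases i with _ | i
    · obtain rfl : j = n + 1 := by omega
      have := F2_mem P (n := n) (by omega) hu (F_Ps Δ P hΔ hP n v hv)
      rw [zero u hu]
      rwa [TensorProduct.tmul_sub, TensorProduct.tmul_smul] at this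
    rcases j with _ | j
    · obtain rfl : i = n := by omega
      have := F2_mem P (n := i) (by omega) (F_Ps Δ P hΔ hP i u hu) hv
      rw [zero v hv]
      rwa [TensorProduct.sub_tmul, ← TensorProduct.smul_tmul'] at this
    · obtain rfl : n = i + (j + 1) := by omega
      have r := F_Ps Δ P hΔ hP i u hu
      have s := F_Ps Δ P hΔ hP j v hv
      have pv : Ps Δ v ∈ F P (j + 1) := by
        have := add_mem (F_mono P (Nat.le_succ j) s) (Submodule.smul_mem _ (2 ^ (j + 1) : K) hv)
        simpa using this
      convert add_mem (F2_mem P (n := i + (j + 1)) (by omega) r pv)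
        (Submodule.smul_mem _ (2 ^ (i + 1) : K)
          (F2_mem P (n := i + (j + 1)) (by omega) hu s)) using 1
      rw [TensorProduct.sub_tmul, TensorProduct.tmul_sub, TensorProduct.tmul_smul,
        ← TensorProduct.smul_tmul', smul_sub, smul_smul, ← pow_add]
      rw [show i + (j + 1) + 1 = i + 1 + (j + 1) by omega]
      abel

lemma F_exhaust (hgen : Algebra.adjoin K (P : Set H) = ⊤) (u : H) : ∃ n, u ∈ F P n := by
  have hu : u ∈ Algebra.adjoin K (P : Set H) := by rw [hgen]; trivial
  induction hu using Algebra.adjoin_induction with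
  | mem x hx => exact ⟨1, mem_F1 P hx⟩
  | algebraMap r => exact ⟨0, by rw [F, pow_zero]; exact Submodule.algebraMap_mem r⟩
  | add x y _ _ hx hy =>
    obtain ⟨n, hn⟩ := hx
    obtain ⟨m, hm⟩ := hy
    exact ⟨max n m, add_mem (F_mono P (le_max_left _ _) hn) (F_mono P (le_max_right _ _) hm)⟩
  | mul x y _ _ hx hy =>
    obtain ⟨n, hn⟩ := hx
    obtain ⟨m, hm⟩ := hy
    exact ⟨n + m, F_mul P hn hm⟩

lemma F2_exhaust (hgen : Algebra.adjoin K (P : Set H) = ⊤) (w : H ⊗[K] H) :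
    ∃ n, w ∈ F2 P (n + 1) := by
  induction w with
  | zero => exact ⟨0, zero_mem _⟩
  | tmul x y =>
    obtain ⟨n, hn⟩ := F_exhaust P hgen x
    obtain ⟨m, hm⟩ := F_exhaust P hgen y
    exact ⟨n + m, F2_mem P (by omega) hn hm⟩
  | add x y hx hy =>
    obtain ⟨n, hn⟩ := hx
    obtain ⟨m, hm⟩ := hy
    exact ⟨max n m, add_mem (F2_mono P (by have := le_max_left n m; omega) hn)
      (F2_mono P (by have := le_max_right n m; omega) hm)⟩

lemma F2_one {w : H ⊗[K] H} (hw : w ∈ F2 P 1) :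
    ∃ p q : H, w = (1 : H) ⊗ₜ[K] p + q ⊗ₜ[K] (1 : H) := by
  induction hw using Submodule.span_induction with
  | zero => exact ⟨0, 0, by simp⟩
  | add a b _ _ ha hb =>
    obtain ⟨p, q, rfl⟩ := ha
    obtain ⟨p', q', rfl⟩ := hb
    exact ⟨p + p', q + q', by simp only [TensorProduct.tmul_add, TensorProduct.add_tmul]; abel⟩
  | smul c a _ ha =>
    obtain ⟨p, q, rfl⟩ := ha
    exact ⟨c • p, c • q, by simp [TensorProduct.smul_tmul']⟩
  | mem w hw =>
    obtain ⟨i, j, hij, u, hu, v, hv, rfl⟩ := hw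
    rcases i with _ | i
    · obtain ⟨c, rfl⟩ := F_zero P hu
      exact ⟨c • v, 0, by simp [Algebra.algebraMap_eq_smul_one, TensorProduct.smul_tmul]⟩
    · obtain rfl : j = 0 := by omega
      obtain ⟨c, rfl⟩ := F_zero P hv
      exact ⟨0, c • u, by simp [Algebra.algebraMap_eq_smul_one, TensorProduct.smul_tmul]⟩

include hΔ in
lemma mul_central (hgen : Algebra.adjoin K (P : Set H) = ⊤) {ψ : H ⊗[K] H}
    (h : ∀ u, ψ * Δ u = Δ u * ψ) (u : H) :
    LinearMap.mul' K H ψ * u = u * LinearMap.mul' K H ψ := by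
  have hu : u ∈ Algebra.adjoin K (P : Set H) := by rw [hgen]; trivial
  induction hu using Algebra.adjoin_induction with
  | mem x hx =>
    have e := congrArg (LinearMap.mul' K H) (h x)
    rw [hΔ x hx] at e
    have l : ∀ w : H ⊗[K] H, LinearMap.mul' K H (w * (x ⊗ₜ[K] (1 : H) + (1 : H) ⊗ₜ[K] x))
        - LinearMap.mul' K H ((x ⊗ₜ[K] (1 : H) + (1 : H) ⊗ₜ[K] x) * w)
        = LinearMap.mul' K H w * x - x * LinearMap.mul' K H w := by
      intro w
      induction w with
      | zero => simp
      | tmul a b =>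
        simp only [add_mul, mul_add, Algebra.TensorProduct.tmul_mul_tmul, one_mul, mul_one,
          map_add, LinearMap.mul'_apply]
        noncomm_ring
      | add a b ha hb =>
        rw [add_mul a b, mul_add _ a b, map_add, map_add, map_add, add_sub_add_comm, ha, hb]
        noncomm_ring
    have := l ψ
    rw [e, sub_self] at this
    exact (sub_eq_zero.1 this.symm)
  | algebraMap r => exact (Algebra.commutes r _).symm
  | add x y _ _ hx hy => rw [mul_add, add_mul, hx, hy]
  | mul x y _ _ hx hy => rw [← mul_assoc, hx, mul_assoc, hy, mul_assoc]

include hΔ hP hco hcm in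
lemma main [CharZero K] (hgen : Algebra.adjoin K (P : Set H) = ⊤) (ε : H →ₐ[K] K)
    (hε : ∀ u, TensorProduct.lid K H (LinearMap.rTensor H ε.toLinearMap (Δ u)) = u)
    (hε' : ∀ u, TensorProduct.rid K H (LinearMap.lTensor H ε.toLinearMap (Δ u)) = u) (n : ℕ) :
    ∀ ψ ∈ F2 P (n + 1), Good Δ ψ → ∃ a : H, (∀ u, a * u = u * a) ∧ ψ = d Δ a := by
  induction n with
  | zero =>
    intro ψ hψ hg
    obtain ⟨p, q, rfl⟩ := F2_one P hψ
    obtain ⟨c, hc⟩ := base Δ ε hε hε' p q hg.coc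
    exact ⟨_, fun u => Algebra.commutes _ _, hc⟩
  | succ n ih =>
    intro ψ hψ hg
    have hm := mul_central Δ P hΔ hgen hg.inv
    have k := key Δ hco hcm hg.coc hg.symm
    have t := F2_T Δ P hΔ hP (n + 1) hψ
    have e : TensorProduct.map (Ps Δ) (Ps Δ) ψ - (2 ^ (n + 1 + 1) : K) • ψ
        = (2 - 2 ^ (n + 1 + 1) : K) • ψ - d Δ (LinearMap.mul' K H ψ) := by
      rw [k]; module
    rw [e] at t
    obtain ⟨a, ha, hea⟩ := ih _ t (hg.comb Δ (good_d Δ hco hcm hm) _)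
    have hne : (2 - 2 ^ (n + 1 + 1) : K) ≠ 0 := by
      have : (2 ^ (n + 1 + 1) : ℕ) ≠ 2 := by
        have := Nat.one_lt_two_pow (n := n + 1) (by omega)
        rw [pow_succ]; omega
      rw [sub_ne_zero]
      intro h
      exact this (by exact_mod_cast h.symm)
    refine ⟨(2 - 2 ^ (n + 1 + 1) : K)⁻¹ • (a + LinearMap.mul' K H ψ), fun u => ?_, ?_⟩
    · rw [smul_mul_assoc, mul_smul_comm, add_mul, mul_add, ha, hm]
    · rw [map_smul, map_add, ← hea, sub_add_cancel, smul_smul, inv_mul_cancel₀ hne, one_smul]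

include hΔ in
lemma coassoc_of_gen (hgen : Algebra.adjoin K (P : Set H) = ⊤) (u : H) :
    TensorProduct.assoc K H H H (LinearMap.rTensor H Δ.toLinearMap (Δ u))
    = LinearMap.lTensor H Δ.toLinearMap (Δ u) := by
  have : ((Algebra.TensorProduct.assoc K K K H H H).toAlgHom.comp
      ((Algebra.TensorProduct.map Δ (AlgHom.id K H)).comp Δ))
      = (Algebra.TensorProduct.map (AlgHom.id K H) Δ).comp Δ := by
    refine AlgHom.ext_of_adjoin_eq_top hgen fun x hx => ?_
    simp [hΔ x hx, TensorProduct.add_tmul, TensorProduct.tmul_add,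
      Algebra.TensorProduct.one_def, add_assoc]
  exact DFunLike.congr_fun this u

include hΔ in
lemma comm_of_gen (hgen : Algebra.adjoin K (P : Set H) = ⊤) (u : H) :
    TensorProduct.comm K H H (Δ u) = Δ u := by
  have : (Algebra.TensorProduct.comm K H H).toAlgHom.comp Δ = Δ := by
    refine AlgHom.ext_of_adjoin_eq_top hgen fun x hx => ?_
    simp [hΔ x hx, add_comm]
  exact DFunLike.congr_fun this u

include hΔ in
lemma counit_of_gen (hgen : Algebra.adjoin K (P : Set H) = ⊤) (ε : H →ₐ[K] K)
    (hε : ∀ x ∈ P, ε x = 0) (u : H) :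
    TensorProduct.lid K H (LinearMap.rTensor H ε.toLinearMap (Δ u)) = u := by
  have : (Algebra.TensorProduct.lid K H).toAlgHom.comp
      ((Algebra.TensorProduct.map ε (AlgHom.id K H)).comp Δ) = AlgHom.id K H := by
    refine AlgHom.ext_of_adjoin_eq_top hgen fun x hx => ?_
    simp [hΔ x hx, hε x hx]
  exact DFunLike.congr_fun this u

include hΔ in
lemma counit_of_gen' (hgen : Algebra.adjoin K (P : Set H) = ⊤) (ε : H →ₐ[K] K)
    (hε : ∀ x ∈ P, ε x = 0) (u : H) :
    TensorProduct.rid K H (LinearMap.lTensor H ε.toLinearMap (Δ u)) = u := by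
  have : (Algebra.TensorProduct.rid K K H).toAlgHom.comp
      ((Algebra.TensorProduct.map (AlgHom.id K H) ε).comp Δ) = AlgHom.id K H := by
    refine AlgHom.ext_of_adjoin_eq_top hgen fun x hx => ?_
    simp [hΔ x hx, hε x hx]
  exact DFunLike.congr_fun this u

include hΔ hP in
theorem final [CharZero K] (hgen : Algebra.adjoin K (P : Set H) = ⊤) (ε : H →ₐ[K] K)
    (hε : ∀ x ∈ P, ε x = 0) (φ : H ⊗[K] H) (hφ : D Δ φ = 0) (hinv : ∀ u, φ * Δ u = Δ u * φ) :
    ∃ a : H, (∀ u, a * u = u * a) ∧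
      φ = (2 : K)⁻¹ • (φ - TensorProduct.comm K H H φ) + d Δ a := by
  have hcm := comm_of_gen Δ P hΔ hgen
  have hinv' : ∀ u, TensorProduct.comm K H H φ * Δ u = Δ u * TensorProduct.comm K H H φ := by
    intro u
    have := congrArg (Algebra.TensorProduct.comm K H H) (hinv u)
    rw [map_mul, map_mul] at this
    have e : Algebra.TensorProduct.comm K H H (Δ u) = Δ u := hcm u
    rw [e] at this
    exact this
  have hg : Good Δ ((2 : K)⁻¹ • (φ + TensorProduct.comm K H H φ)) := by
    refine ⟨?_, ?_, fun u => ?_⟩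
    · rw [map_smul, map_add, D_comm Δ hcm, hφ]; simp
    · rw [map_smul, map_add, TensorProduct.comm_comm, add_comm]
    · rw [smul_mul_assoc, mul_smul_comm, add_mul, mul_add, hinv, hinv']
  obtain ⟨n, hn⟩ := F2_exhaust P hgen ((2 : K)⁻¹ • (φ + TensorProduct.comm K H H φ))
  obtain ⟨a, ha, h⟩ := main Δ (coassoc_of_gen Δ P hΔ hgen) hcm P hΔ hP hgen ε
    (counit_of_gen Δ P hΔ hgen ε hε) (counit_of_gen' Δ P hΔ hgen ε hε) n _ hn hg
  refine ⟨a, ha, ?_⟩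
  rw [← h]
  module

end filtration

section env
attribute [local instance] LieRing.ofAssociativeRing
variable (K : Type*) (g : Type*) [Field K] [LieRing g] [LieAlgebra K g]

lemma env_lie (x y : g) : UniversalEnvelopingAlgebra.ι K ⁅x, y⁆ =
    UniversalEnvelopingAlgebra.ι K x * UniversalEnvelopingAlgebra.ι K y
    - UniversalEnvelopingAlgebra.ι K y * UniversalEnvelopingAlgebra.ι K x := by
  rw [LieHom.map_lie, LieRing.of_associative_ring_bracket]

lemma env_counit : ∃ ε : UniversalEnvelopingAlgebra K g →ₐ[K] K,
    ∀ x, ε (UniversalEnvelopingAlgebra.ι K x) = 0 :=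
  ⟨UniversalEnvelopingAlgebra.lift K (0 : g →ₗ⁅K⁆ K), fun x => by
    rw [UniversalEnvelopingAlgebra.lift_ι_apply]; rfl⟩

/-- the space of generators -/
def gens : Submodule K (UniversalEnvelopingAlgebra K g) :=
  LinearMap.range ((UniversalEnvelopingAlgebra.ι K (L := g)) :
    g →ₗ[K] UniversalEnvelopingAlgebra K g)

lemma mem_gens {u : UniversalEnvelopingAlgebra K g} :
    u ∈ gens K g ↔ ∃ x : g, UniversalEnvelopingAlgebra.ι K x = u := Iff.rfl

lemma env_gen : Algebra.adjoin K (gens K g : Set (UniversalEnvelopingAlgebra K g)) = ⊤ := by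
  have hs : Function.Surjective (UniversalEnvelopingAlgebra.mkAlgHom K g) :=
    fun x => Quotient.inductionOn' x fun a => ⟨a, rfl⟩
  rw [eq_top_iff]
  intro u _
  obtain ⟨t, rfl⟩ := hs u
  induction t using TensorAlgebra.induction with
  | algebraMap r => rw [AlgHom.commutes]; exact Subalgebra.algebraMap_mem _ r
  | ι x => exact Algebra.subset_adjoin ⟨x, UniversalEnvelopingAlgebra.ι_apply K x⟩
  | mul a b ha hb => rw [map_mul]; exact mul_mem (ha trivial) (hb trivial)
  | add a b ha hb => rw [map_add]; exact add_mem (ha trivial) (hb trivial)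

end env
end CoH
end

noncomputable section

variable (K g : Type*) [Field K] [CharZero K] [LieRing g] [LieAlgebra K g]

local notation "U" => UniversalEnvelopingAlgebra K g
local notation "ιU" => UniversalEnvelopingAlgebra.ι K (L := g)

/-- Over a field of characteristic zero, if `φ ∈ U(g) ⊗ U(g)` is a
co-Hochschild 2-cocycle which is invariant, i.e. `[φ, Δ(u)] = 0` for all `u ∈ U(g)`,
then there is a central element `a ∈ Z(U(g))` with
`φ = Alt₂(φ) + a⊗1 + 1⊗a − Δ(a)`, where `Alt₂(φ) = (φ − τ(φ))/2`. -/
theorem invariant_cocycle_eq_alternation_add_central_coboundary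
    (Δ' : U →ₐ[K] U ⊗[K] U)
    (hΔ' : ∀ x : g, Δ' (ιU x) = ιU x ⊗ₜ[K] (1 : U) + (1 : U) ⊗ₜ[K] ιU x)
    (φ : U ⊗[K] U)
    (hφ : (1 : U) ⊗ₜ[K] φ + LinearMap.lTensor U Δ'.toLinearMap φ
      = TensorProduct.assoc K U U U (φ ⊗ₜ[K] (1 : U) + LinearMap.rTensor U Δ'.toLinearMap φ))
    (hinv : ∀ u : U, φ * Δ' u = Δ' u * φ) :
    ∃ a : U, (∀ u : U, a * u = u * a) ∧
      φ = (2 : K)⁻¹ • (φ - TensorProduct.comm K U U φ)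
        + a ⊗ₜ[K] (1 : U) + (1 : U) ⊗ₜ[K] a - Δ' a := by
  obtain ⟨ε, hε⟩ := CoH.env_counit K g
  obtain ⟨a, ha, h⟩ := CoH.final Δ' (CoH.gens K g)
    (by rintro _ ⟨x, rfl⟩; exact hΔ' x)
    (by rintro _ ⟨x, rfl⟩ _ ⟨y, rfl⟩; exact ⟨⁅x, y⁆, CoH.env_lie K g x y⟩)
    (CoH.env_gen K g) ε (by rintro _ ⟨x, rfl⟩; exact hε x) φ
    (by rw [CoH.D_apply, hφ, sub_self]) hinv
  refine ⟨a, ha, ?_⟩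
  rw [CoH.d_apply, ← add_sub_assoc, ← add_assoc] at h
  exact h

end
end

section
/- Let k be a field of characteristic zero, g a Lie algebra over k, and U(g) its universal enveloping algebra with its standard bialgebra structure. Let X, Y ∈ U(g)⊗U(g) be antisymmetric (τ(X) = −X, τ(Y) = −Y), invariant ([X, Δ(u)] = 0 and [Y, Δ(u)] = 0 for all u ∈ U(g)) co-Hochschild 2-cocycles (1⊗X + (I⊗Δ)(X) = X⊗1 + (Δ⊗I)(X), and likewise for Y). Then there exists a central element a ∈ Z(U(g)) such that [X, Y] = a⊗1 + 1⊗a − Δ(a); in particular the induced Lie bracket on gauge classes of invariant infinitesimal twists of U(g) is trivial. -/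
open scoped TensorProduct

noncomputable section

variable (K g : Type*) [Field K] [CharZero K] [LieRing g] [LieAlgebra K g]

local notation "U" => UniversalEnvelopingAlgebra K g
local notation "ιU" => UniversalEnvelopingAlgebra.ι K (L := g)

section helpers
variable {F A : Type*} [Field F] [Ring A] [Algebra F A]

/-- The deviation from primitivity. -/
def devPrim (d : A →ₗ[F] A ⊗[F] A) : A →ₗ[F] A ⊗[F] A :=
  d - (TensorProduct.mk F A A).flip 1 - TensorProduct.mk F A A 1

def tau12 : A ⊗[F] (A ⊗[F] A) →ₗ[F] A ⊗[F] (A ⊗[F] A) :=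
  (TensorProduct.leftComm F A A A).toLinearMap

def tau23 : A ⊗[F] (A ⊗[F] A) →ₗ[F] A ⊗[F] (A ⊗[F] A) :=
  LinearMap.lTensor A (TensorProduct.comm F A A).toLinearMap

theorem tau12_tmul (a b c : A) :
    tau12 (F := F) (a ⊗ₜ[F] (b ⊗ₜ[F] c)) = b ⊗ₜ[F] (a ⊗ₜ[F] c) := by
  simp [tau12]

theorem tau23_tmul (a b c : A) :
    tau23 (F := F) (a ⊗ₜ[F] (b ⊗ₜ[F] c)) = a ⊗ₜ[F] (c ⊗ₜ[F] b) := by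
  simp [tau23]

theorem devPrim_comm (d : A →ₗ[F] A ⊗[F] A)
    (hd : ∀ a, TensorProduct.comm F A A (d a) = d a) (a : A) :
    TensorProduct.comm F A A (devPrim d a) = devPrim d a := by
  simp only [devPrim, LinearMap.sub_apply, map_sub, hd, LinearMap.flip_apply,
    TensorProduct.mk_apply, TensorProduct.comm_tmul]
  abel

theorem tau12_assoc (t : A ⊗[F] A) (v : A) :
    tau12 (TensorProduct.assoc F A A A (t ⊗ₜ[F] v))
      = TensorProduct.assoc F A A A ((TensorProduct.comm F A A t) ⊗ₜ[F] v) := by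
  induction t with
  | zero => simp
  | tmul a b => simp [tau12_tmul]
  | add a b ha hb => simp only [TensorProduct.add_tmul, map_add, ha, hb]

theorem tau_cycle_assoc (t : A ⊗[F] A) (v : A) :
    tau12 (tau23 (TensorProduct.assoc F A A A (t ⊗ₜ[F] v))) = v ⊗ₜ[F] t := by
  induction t with
  | zero => simp
  | tmul a b => simp [tau12_tmul, tau23_tmul]
  | add a b ha hb => simp only [TensorProduct.add_tmul, TensorProduct.tmul_add, map_add, ha, hb]

/-- An antisymmetric cocycle for a cocommutative comultiplication has primitive legs. -/
theorem dev_zero [CharZero F] (d : A →ₗ[F] A ⊗[F] A)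
    (hd : ∀ a, TensorProduct.comm F A A (d a) = d a) (X : A ⊗[F] A)
    (hXa : TensorProduct.comm F A A X = -X)
    (hX : (1 : A) ⊗ₜ[F] X + LinearMap.lTensor A d X
      = TensorProduct.assoc F A A A (X ⊗ₜ[F] (1 : A) + LinearMap.rTensor A d X)) :
    LinearMap.lTensor A (devPrim d) X = 0 ∧ LinearMap.rTensor A (devPrim d) X = 0 := by
  have h1 : ∀ Z : A ⊗[F] A, LinearMap.lTensor A (devPrim d) Z - 
      TensorProduct.assoc F A A A (LinearMap.rTensor A (devPrim d) Z) =
      ((1 : A) ⊗ₜ[F] Z + LinearMap.lTensor A d Z) - 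
      TensorProduct.assoc F A A A (Z ⊗ₜ[F] (1 : A) + LinearMap.rTensor A d Z) := by
    intro Z
    induction Z with
    | zero => simp
    | tmul a b =>
      simp only [LinearMap.lTensor_tmul, LinearMap.rTensor_tmul, devPrim, LinearMap.sub_apply,
        LinearMap.flip_apply, TensorProduct.mk_apply, TensorProduct.tmul_sub,
        TensorProduct.sub_tmul, map_sub, map_add, TensorProduct.assoc_tmul]
      abel
    | add a b ha hb =>
      have := congrArg₂ (· + ·) ha hb
      simp only [TensorProduct.add_tmul, TensorProduct.tmul_add, map_add] at this ⊢
      refine Eq.trans ?_ (this.trans ?_) <;> abel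
  have h2 : LinearMap.lTensor A (devPrim d) X = 
      TensorProduct.assoc F A A A (LinearMap.rTensor A (devPrim d) X) := by
    rw [← sub_eq_zero, h1, hX, sub_self]
  have h3 : ∀ Z : A ⊗[F] A, tau12 (TensorProduct.assoc F A A A (LinearMap.rTensor A (devPrim d) Z))
      = TensorProduct.assoc F A A A (LinearMap.rTensor A (devPrim d) Z) := by
    intro Z
    induction Z with
    | zero => simp
    | tmul a b => rw [LinearMap.rTensor_tmul, tau12_assoc, devPrim_comm d hd]
    | add a b ha hb => simp only [map_add, ha, hb]
  have h4 : ∀ Z : A ⊗[F] A, tau23 (LinearMap.lTensor A (devPrim d) Z)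
      = LinearMap.lTensor A (devPrim d) Z := by
    intro Z
    induction Z with
    | zero => simp
    | tmul a b =>
      rw [LinearMap.lTensor_tmul, tau23, LinearMap.lTensor_tmul, LinearEquiv.coe_coe,
        devPrim_comm d hd]
    | add a b ha hb => simp only [map_add, ha, hb]
  have h5 : ∀ Z : A ⊗[F] A,
      tau12 (tau23 (TensorProduct.assoc F A A A (LinearMap.rTensor A (devPrim d) Z)))
      = LinearMap.lTensor A (devPrim d) (TensorProduct.comm F A A Z) := by
    intro Z
    induction Z with
    | zero => simp
    | tmul a b => rw [LinearMap.rTensor_tmul, tau_cycle_assoc, TensorProduct.comm_tmul,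
        LinearMap.lTensor_tmul]
    | add a b ha hb => simp only [map_add, ha, hb]
  have h6 := h5 X
  rw [hXa, map_neg, ← h2, h4, h2, h3] at h6
  have h7 : TensorProduct.assoc F A A A (LinearMap.rTensor A (devPrim d) X) = 0 :=
by
    have h8 := add_eq_zero_iff_eq_neg.mpr h6
    rw [← two_smul F] at h8
    exact (smul_eq_zero.mp h8).resolve_left two_ne_zero
  refine ⟨h2.trans h7, ?_⟩
  simpa using h7

theorem exists_prim_sum (f : A →ₗ[F] A ⊗[F] A) (X : A ⊗[F] A)
    (hl : LinearMap.lTensor A f X = 0) (hr : LinearMap.rTensor A f X = 0) :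
    ∃ (n : ℕ) (x y : Fin n → A), (∀ i, f (x i) = 0) ∧ (∀ i, f (y i) = 0) ∧
      X = ∑ i, x i ⊗ₜ[F] y i := by
  have hex : Function.Exact (LinearMap.ker f).subtype f := LinearMap.exact_subtype_ker_map f
  obtain ⟨X', rfl⟩ := (Module.Flat.rTensor_exact A hex X).1 hr
  have h1 : LinearMap.lTensor (LinearMap.ker f) f X' = 0 := by
    have hinj : Function.Injective
        (LinearMap.rTensor (A ⊗[F] A) (LinearMap.ker f).subtype) :=
      Module.Flat.rTensor_preserves_injective_linearMap _ (LinearMap.ker f).subtype_injective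
    apply hinj
    rw [map_zero, ← hl]
    simp only [← LinearMap.comp_apply, LinearMap.rTensor_comp_lTensor,
      LinearMap.lTensor_comp_rTensor]
  obtain ⟨X'', rfl⟩ := (Module.Flat.lTensor_exact (LinearMap.ker f) hex X').1 h1
  clear h1 hl hr
  induction X'' with
  | zero => exact ⟨0, Fin.elim0, Fin.elim0, fun i => i.elim0, fun i => i.elim0, by simp⟩
  | tmul a b => exact ⟨1, fun _ => a, fun _ => b, fun _ => a.2, fun _ => b.2, by simp⟩
  | add a b ha hb =>
    obtain ⟨n, x, y, hx, hy, h⟩ := ha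
    obtain ⟨m, z, w, hz, hw, h'⟩ := hb
    refine ⟨n + m, Fin.append x z, Fin.append y w, ?_, ?_, ?_⟩
    · intro i
      refine Fin.addCases (fun i => ?_) (fun i => ?_) i <;> simp [hx, hz]
    · intro i
      refine Fin.addCases (fun i => ?_) (fun i => ?_) i <;> simp [hy, hw]
    · rw [map_add, map_add, h, h', Fin.sum_univ_add]
      simp


def mulL : A ⊗[F] (A ⊗[F] A) →ₗ[F] A ⊗[F] A :=
  (LinearMap.rTensor A (LinearMap.mul' F A)) ∘ₗ (TensorProduct.assoc F A A A).symm.toLinearMap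

def mulR : A ⊗[F] (A ⊗[F] A) →ₗ[F] A ⊗[F] A := LinearMap.lTensor A (LinearMap.mul' F A)

def mul3 : A ⊗[F] (A ⊗[F] A) →ₗ[F] A := LinearMap.mul' F A ∘ₗ mulR

theorem mulL_tmul (a b c : A) : mulL (F := F) (a ⊗ₜ[F] (b ⊗ₜ[F] c)) = (a * b) ⊗ₜ[F] c := by
  simp [mulL]

theorem mulR_tmul (a b c : A) : mulR (F := F) (a ⊗ₜ[F] (b ⊗ₜ[F] c)) = a ⊗ₜ[F] (b * c) := by
  simp [mulR]

theorem mul3_tmul (a b c : A) : mul3 (F := F) (a ⊗ₜ[F] (b ⊗ₜ[F] c)) = a * (b * c) := by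
  simp [mul3, mulR_tmul]

theorem d_mul3 (d : A →ₐ[F] A ⊗[F] A) (p q r : A)
    (hp : d p = p ⊗ₜ[F] 1 + 1 ⊗ₜ[F] p) (hq : d q = q ⊗ₜ[F] 1 + 1 ⊗ₜ[F] q)
    (hr : d r = r ⊗ₜ[F] 1 + 1 ⊗ₜ[F] r) (t : A ⊗[F] (A ⊗[F] A))
    (ht : t = p ⊗ₜ[F] (q ⊗ₜ[F] r)) :
    d (mul3 t) = mul3 t ⊗ₜ[F] 1 + 1 ⊗ₜ[F] mul3 t
      + (mulL t + mulL (tau23 t) + mulL (tau23 (tau12 t)))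
      + (mulR t + mulR (tau12 t) + mulR (tau12 (tau23 t))) := by
  subst ht
  simp only [mul3_tmul, mulL_tmul, mulR_tmul, tau12_tmul, tau23_tmul, map_mul, hp, hq, hr,
    mul_add, add_mul, Algebra.TensorProduct.tmul_mul_tmul, one_mul, mul_one]
  abel

theorem prim_bracket (d : A →ₐ[F] A ⊗[F] A) (p q : A)
    (hp : d p = p ⊗ₜ[F] 1 + 1 ⊗ₜ[F] p) (hq : d q = q ⊗ₜ[F] 1 + 1 ⊗ₜ[F] q) :
    d (p * q - q * p) = (p * q - q * p) ⊗ₜ[F] 1 + 1 ⊗ₜ[F] (p * q - q * p) := by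
  simp only [map_sub, map_mul, hp, hq, mul_add, add_mul, Algebra.TensorProduct.tmul_mul_tmul,
    one_mul, mul_one, TensorProduct.sub_tmul, TensorProduct.tmul_sub]
  abel

theorem invar_sum {n : ℕ} (x y : Fin n → A) (X : A ⊗[F] A) (hX : X = ∑ i, x i ⊗ₜ[F] y i)
    (p : A) (h : X * (p ⊗ₜ[F] 1 + 1 ⊗ₜ[F] p) = (p ⊗ₜ[F] 1 + 1 ⊗ₜ[F] p) * X) :
    ∑ i, (x i * p - p * x i) ⊗ₜ[F] y i = - ∑ i, x i ⊗ₜ[F] (y i * p - p * y i) := by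
  rw [← sub_eq_zero] at h ⊢
  rw [← h, hX]
  simp only [mul_add, add_mul, Finset.sum_mul, Finset.mul_sum,
    Algebra.TensorProduct.tmul_mul_tmul, one_mul, mul_one, TensorProduct.sub_tmul,
    TensorProduct.tmul_sub, Finset.sum_sub_distrib, Finset.sum_add_distrib]
  abel

/-- The main computation. -/
theorem main_comp [CharZero F] (d : A →ₐ[F] A ⊗[F] A) (X Y : A ⊗[F] A)
    (hXa : TensorProduct.comm F A A X = -X) (hYa : TensorProduct.comm F A A Y = -Y)
    (hXi : ∀ u : A, X * d u = d u * X) (hYi : ∀ u : A, Y * d u = d u * Y)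
    {n m : ℕ} (x y : Fin n → A) (z w : Fin m → A)
    (hX : X = ∑ i, x i ⊗ₜ[F] y i) (hY : Y = ∑ j, z j ⊗ₜ[F] w j)
    (hx : ∀ i, d (x i) = x i ⊗ₜ[F] 1 + 1 ⊗ₜ[F] x i)
    (hy : ∀ i, d (y i) = y i ⊗ₜ[F] 1 + 1 ⊗ₜ[F] y i)
    (hz : ∀ i, d (z i) = z i ⊗ₜ[F] 1 + 1 ⊗ₜ[F] z i)
    (hw : ∀ i, d (w i) = w i ⊗ₜ[F] 1 + 1 ⊗ₜ[F] w i) :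
    ∃ a : A, (∀ p : A, d p = p ⊗ₜ[F] 1 + 1 ⊗ₜ[F] p → a * p = p * a) ∧
      X * Y - Y * X = a ⊗ₜ[F] (1 : A) + (1 : A) ⊗ₜ[F] a - d a := by
  have iX : ∀ p, d p = p ⊗ₜ[F] 1 + 1 ⊗ₜ[F] p → _ := fun p hp =>
    invar_sum x y X hX p (by rw [← hp]; exact hXi p)
  have iY : ∀ p, d p = p ⊗ₜ[F] 1 + 1 ⊗ₜ[F] p → _ := fun p hp =>
    invar_sum z w Y hY p (by rw [← hp]; exact hYi p)
  have aX : ∑ i, y i ⊗ₜ[F] x i = - ∑ i, x i ⊗ₜ[F] y i := by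
    rw [← hX, ← hXa, hX]; simp [map_sum]
  have aY : ∑ i, w i ⊗ₜ[F] z i = - ∑ i, z i ⊗ₜ[F] w i := by
    rw [← hY, ← hYa, hY]; simp [map_sum]
  obtain ⟨T, hT⟩ : ∃ T : A ⊗[F] (A ⊗[F] A),
    T = ∑ i, ∑ j, (x i * z j - z j * x i) ⊗ₜ[F] (y i ⊗ₜ[F] w j) := ⟨_, rfl⟩
  -- first form
  have e1 : T = - ∑ i, ∑ j, x i ⊗ₜ[F] ((y i * z j - z j * y i) ⊗ₜ[F] w j) := by
    rw [hT, Finset.sum_comm, Finset.sum_comm (s := Finset.univ (α := Fin n)),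
      ← Finset.sum_neg_distrib]
    refine Finset.sum_congr rfl fun j _ => ?_
    have := congrArg (fun t => TensorProduct.assoc F A A A (t ⊗ₜ[F] w j)) (iX (z j) (hz j))
    simpa only [TensorProduct.sum_tmul, TensorProduct.neg_tmul, map_sum, map_neg,
      TensorProduct.assoc_tmul] using this
  have e2 : T = ∑ i, ∑ j, x i ⊗ₜ[F] (z j ⊗ₜ[F] (y i * w j - w j * y i)) := by
    rw [e1, ← Finset.sum_neg_distrib]
    refine Finset.sum_congr rfl fun i _ => ?_
    have := congrArg (fun t => x i ⊗ₜ[F] t) (iY (y i) (hy i))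
    simp only [TensorProduct.tmul_sum, TensorProduct.tmul_neg, TensorProduct.sub_tmul,
      TensorProduct.tmul_sub, Finset.sum_sub_distrib] at this ⊢
    rw [neg_sub, this, neg_sub]
  have e3 : T = - ∑ i, ∑ j, (x i * w j - w j * x i) ⊗ₜ[F] (z j ⊗ₜ[F] y i) := by
    rw [e2, Finset.sum_comm, Finset.sum_comm (s := Finset.univ (α := Fin n)),
      ← Finset.sum_neg_distrib]
    refine Finset.sum_congr rfl fun j _ => ?_
    have := congrArg (fun t => LinearMap.lTensor A (TensorProduct.mk F A A (z j)) t)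
      (iX (w j) (hw j))
    simp only [map_sum, map_neg, LinearMap.lTensor_tmul, TensorProduct.mk_apply] at this
    rw [this, neg_neg]
  have e4 : T = ∑ i, ∑ j, (x i * z j - z j * x i) ⊗ₜ[F] (w j ⊗ₜ[F] y i) := by
    rw [e3, ← Finset.sum_neg_distrib]
    refine Finset.sum_congr rfl fun i _ => ?_
    have := congrArg (fun t => TensorProduct.assoc F A A A
      ((LinearMap.rTensor A (LinearMap.mulLeft F (x i) - LinearMap.mulRight F (x i)) t)
        ⊗ₜ[F] y i)) aY
    simp only [map_sum, map_neg, LinearMap.rTensor_tmul, TensorProduct.sum_tmul,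
      TensorProduct.neg_tmul, TensorProduct.assoc_tmul, LinearMap.sub_apply,
      LinearMap.mulLeft_apply, LinearMap.mulRight_apply] at this
    rw [this, neg_neg]
  have s23 : tau23 T = T := by
    conv_rhs => rw [e4]
    rw [hT]
    simp only [map_sum, tau23_tmul]
  have s12 : tau12 T = T := by
    conv_rhs => rw [e1]
    rw [hT]
    simp only [map_sum, tau12_tmul]
    rw [Finset.sum_comm, Finset.sum_comm (s := Finset.univ (α := Fin n)),
      ← Finset.sum_neg_distrib]
    refine Finset.sum_congr rfl fun j _ => ?_
    have := congrArg (fun t => TensorProduct.assoc F A A A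
      ((LinearMap.lTensor A (LinearMap.mulRight F (z j) - LinearMap.mulLeft F (z j)) t)
        ⊗ₜ[F] w j)) aX
    simpa only [map_sum, map_neg, LinearMap.lTensor_tmul, TensorProduct.sum_tmul,
      TensorProduct.neg_tmul, TensorProduct.assoc_tmul, LinearMap.sub_apply,
      LinearMap.mulLeft_apply, LinearMap.mulRight_apply] using this
  have hcomm : X * Y - Y * X = mulR T + mulL T := by
    have hR : mulR T = ∑ i, ∑ j, (x i * z j - z j * x i) ⊗ₜ[F] (y i * w j) := by
      rw [hT]; simp only [map_sum, mulR_tmul]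
    have hL : mulL T = ∑ i, ∑ j, (z j * x i) ⊗ₜ[F] (y i * w j - w j * y i) := by
      rw [← s12, e2]; simp only [map_sum, mulL_tmul, tau12_tmul]
    rw [hR, hL, hX, hY, Finset.sum_mul_sum, Finset.sum_mul_sum,
      Finset.sum_comm (s := Finset.univ (α := Fin m)), ← Finset.sum_sub_distrib,
      ← Finset.sum_add_distrib]
    refine Finset.sum_congr rfl fun i _ => ?_
    rw [← Finset.sum_sub_distrib, ← Finset.sum_add_distrib]
    refine Finset.sum_congr rfl fun j _ => ?_
    simp only [Algebra.TensorProduct.tmul_mul_tmul, TensorProduct.sub_tmul,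
      TensorProduct.tmul_sub]
    abel
  have hd : d (mul3 T) = mul3 T ⊗ₜ[F] 1 + 1 ⊗ₜ[F] mul3 T
      + (mulL T + mulL (tau23 T) + mulL (tau23 (tau12 T)))
      + (mulR T + mulR (tau12 T) + mulR (tau12 (tau23 T))) := by
    rw [hT]
    simp only [map_sum, TensorProduct.sum_tmul, TensorProduct.tmul_sum,
      ← Finset.sum_add_distrib]
    refine Finset.sum_congr rfl fun i _ => Finset.sum_congr rfl fun j _ => ?_
    exact d_mul3 d _ _ _ (prim_bracket d _ _ (hx i) (hz j)) (hy i) (hw j) _ rfl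
  rw [s12, s23, s12] at hd
  refine ⟨-(3 : F)⁻¹ • mul3 T, ?_, ?_⟩
  · intro p hp
    rw [smul_mul_assoc, mul_smul_comm]
    congr 1
    have hc : mul3 T = ∑ i, ∑ j, (x i * z j - z j * x i) * (y i * w j) := by
      rw [hT]; simp only [map_sum, mul3_tmul]
    -- the derivation `[·, p]` applied to each leg
    have k1 : ∑ i, ∑ j, (((x i * p - p * x i) * z j - z j * (x i * p - p * x i)) * (y i * w j))
        = - ∑ i, ∑ j, ((x i * z j - z j * x i) * ((y i * p - p * y i) * w j)) := by
      rw [Finset.sum_comm, Finset.sum_comm (s := Finset.univ (α := Fin n)),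
        ← Finset.sum_neg_distrib]
      refine Finset.sum_congr rfl fun j _ => ?_
      have := congrArg (fun t => LinearMap.mul' F A (TensorProduct.map
        (LinearMap.mulRight F (z j) - LinearMap.mulLeft F (z j))
        (LinearMap.mulRight F (w j)) t)) (iX p hp)
      simpa only [map_sum, map_neg, TensorProduct.map_tmul, LinearMap.mul'_apply,
        LinearMap.sub_apply, LinearMap.mulLeft_apply, LinearMap.mulRight_apply] using this
    have k2 : ∑ i, ∑ j, ((x i * (z j * p - p * z j) - (z j * p - p * z j) * x i) * (y i * w j))
        = - ∑ i, ∑ j, ((x i * z j - z j * x i) * (y i * (w j * p - p * w j))) := by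
      rw [← Finset.sum_neg_distrib]
      refine Finset.sum_congr rfl fun i _ => ?_
      have := congrArg (fun t => LinearMap.mul' F A (TensorProduct.map
        (LinearMap.mulLeft F (x i) - LinearMap.mulRight F (x i))
        (LinearMap.mulLeft F (y i)) t)) (iY p hp)
      simpa only [map_sum, map_neg, TensorProduct.map_tmul, LinearMap.mul'_apply,
        LinearMap.sub_apply, LinearMap.mulLeft_apply, LinearMap.mulRight_apply] using this
    rw [← sub_eq_zero]
    rw [eq_neg_iff_add_eq_zero] at k1 k2
    have k3 := congrArg₂ (· + ·) k1 k2
    simp only [add_zero, ← Finset.sum_add_distrib] at k3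
    rw [← k3, hc]
    simp only [Finset.sum_mul, Finset.mul_sum, ← Finset.sum_sub_distrib]
    refine Finset.sum_congr rfl fun i _ => Finset.sum_congr rfl fun j _ => ?_
    noncomm_ring
  · rw [map_smul, hd, hcomm]
    have h3 : (3 : F) ≠ 0 := three_ne_zero
    rw [← TensorProduct.smul_tmul', TensorProduct.tmul_smul]
    have e : ∀ P Q R S : A ⊗[F] A, S + R = (-(3 : F)⁻¹) • P + (-(3 : F)⁻¹) • Q -
        (-(3 : F)⁻¹) • (P + Q + (R + R + R) + (S + S + S)) := by
      intro P Q R S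
      match_scalars <;> field_simp <;> ring
    exact e _ _ _ _

end helpers

/-- Over a field of characteristic zero, let `X, Y ∈ U(g) ⊗ U(g)` be
antisymmetric, invariant co-Hochschild 2-cocycles. Then the commutator `[X,Y]` is the
coboundary of a central element `a ∈ Z(U(g))`: `[X,Y] = a⊗1 + 1⊗a − Δ(a)`.  In
particular the induced Lie bracket on gauge classes of invariant infinitesimal twists
of `U(g)` is trivial. -/
theorem commutator_of_invariant_twists_is_central_coboundary
    (Δ' : U →ₐ[K] U ⊗[K] U)
    (hΔ' : ∀ x : g, Δ' (ιU x) = ιU x ⊗ₜ[K] (1 : U) + (1 : U) ⊗ₜ[K] ιU x)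
    (X Y : U ⊗[K] U)
    (hXa : TensorProduct.comm K U U X = -X) (hYa : TensorProduct.comm K U U Y = -Y)
    (hXi : ∀ u : U, X * Δ' u = Δ' u * X) (hYi : ∀ u : U, Y * Δ' u = Δ' u * Y)
    (hX : (1 : U) ⊗ₜ[K] X + LinearMap.lTensor U Δ'.toLinearMap X
      = TensorProduct.assoc K U U U (X ⊗ₜ[K] (1 : U) + LinearMap.rTensor U Δ'.toLinearMap X))
    (hY : (1 : U) ⊗ₜ[K] Y + LinearMap.lTensor U Δ'.toLinearMap Y
      = TensorProduct.assoc K U U U (Y ⊗ₜ[K] (1 : U) + LinearMap.rTensor U Δ'.toLinearMap Y)) :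
    ∃ a : U, (∀ u : U, a * u = u * a) ∧
      X * Y - Y * X = a ⊗ₜ[K] (1 : U) + (1 : U) ⊗ₜ[K] a - Δ' a := by
  have hco : ∀ a, TensorProduct.comm K U U (Δ'.toLinearMap a) = Δ'.toLinearMap a := by
    intro a
    have : ((Algebra.TensorProduct.comm K U U).toAlgHom.comp Δ') = Δ' := by
      let _ : LieRing (U ⊗[K] U) := LieRing.ofAssociativeRing
      apply UniversalEnvelopingAlgebra.hom_ext
      refine LieHom.ext fun x => ?_
      have h : (Algebra.TensorProduct.comm K U U) (Δ' (ιU x)) = Δ' (ιU x) := by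
        rw [hΔ', map_add, Algebra.TensorProduct.comm_tmul, Algebra.TensorProduct.comm_tmul,
          add_comm]
      exact h
    exact DFunLike.congr_fun this a
  obtain ⟨hXl, hXr⟩ := dev_zero _ hco X hXa hX
  obtain ⟨hYl, hYr⟩ := dev_zero _ hco Y hYa hY
  obtain ⟨n, x, y, hx, hy, hXs⟩ := exists_prim_sum _ X hXl hXr
  obtain ⟨m, z, w, hz, hw, hYs⟩ := exists_prim_sum _ Y hYl hYr
  have hprim : ∀ u : U, devPrim Δ'.toLinearMap u = 0 → Δ' u = u ⊗ₜ[K] 1 + 1 ⊗ₜ[K] u := by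
    intro u hu
    have h : Δ' u - u ⊗ₜ[K] 1 - 1 ⊗ₜ[K] u = 0 := hu
    rw [sub_sub, sub_eq_zero] at h
    exact h
  obtain ⟨a, ha, hXY⟩ := main_comp Δ' X Y hXa hYa hXi hYi x y z w hXs hYs
    (fun i => hprim _ (hx i)) (fun i => hprim _ (hy i))
    (fun i => hprim _ (hz i)) (fun i => hprim _ (hw i))
  refine ⟨a, fun u => ?_, hXY⟩
  -- `a` commutes with the generators, hence with everything
  have hmem : ∀ x : g, ιU x ∈ Subalgebra.centralizer K {a} := by
    intro x
    rw [Subalgebra.mem_centralizer_iff]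
    rintro b rfl
    exact ha _ (hΔ' x)
  let _ : LieRing (Subalgebra.centralizer K {a}) := LieRing.ofAssociativeRing
  let _ : LieAlgebra K (Subalgebra.centralizer K {a}) := LieAlgebra.ofAssociativeAlgebra
  let _ : LieRing U := LieRing.ofAssociativeRing
  let _ : LieAlgebra K U := LieAlgebra.ofAssociativeAlgebra
  let f : g →ₗ⁅K⁆ Subalgebra.centralizer K {a} :=
    { toFun := fun x => ⟨ιU x, hmem x⟩
      map_add' := fun x y => Subtype.ext (by simp)
      map_smul' := fun r x => Subtype.ext (by simp)
      map_lie' := fun {x y} => Subtype.ext (by simp [LieRing.of_associative_ring_bracket]) }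
  have hid : (Subalgebra.centralizer K {a}).val.comp (UniversalEnvelopingAlgebra.lift K f)
      = AlgHom.id K U := by
    apply UniversalEnvelopingAlgebra.hom_ext
    refine LieHom.ext fun x => ?_
    have h : ((UniversalEnvelopingAlgebra.lift K f (ιU x) :
        Subalgebra.centralizer K {a}) : U) = ιU x := by
      rw [UniversalEnvelopingAlgebra.lift_ι_apply]
      rfl
    exact h
  have hu : ((UniversalEnvelopingAlgebra.lift K f u : Subalgebra.centralizer K {a}) : U) = u :=
    DFunLike.congr_fun hid u
  have hc := (UniversalEnvelopingAlgebra.lift K f u).2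
  rw [hu, Subalgebra.mem_centralizer_iff] at hc
  exact hc a rfl

end
end
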